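/- arXiv:1510.02141 — 3 statements merged into one kernel-verified Lean document; each statement's English description precedes it below -/
import Mathlib

section
/- Let X be a topological space and let b : List Bool → Opens X assign to each finite binary sequence an open subset of X, such that (i) b is monotone under extension, i.e. b u ≤ b (u ++ v) for all finite binary sequences u, v, and (ii) for every infinite binary sequence α : ℕ → Bool, the supremum over n ∈ ℕ of b (α↾n) equals ⊤ (all of X), where α↾n denotes the list of the first n values of α. Then ⨆_{n ∈ ℕ} ⨅_{u : List Bool, u.length = n} b u = ⊤. (This is the semantic core of the Fourman–Hyland proposition that in any topological model the full Fan Theorem FAN_full holds: if the open truth values of 'u ∈ B' form a bar on every external infinite binary sequence and are closed under extension, then the truth value of 'B is uniform' is ⊤.) -/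
/-- The full Fan Theorem: a bar closed under extensions is uniform. -/
theorem exists_uniform_of_bar {B : Set (List Bool)} (hB : ∀ u v, u ∈ B → u ++ v ∈ B)
    (hbar : ∀ α : ℕ → Bool, ∃ n, List.ofFn (fun i : Fin n => α i) ∈ B) :
    ∃ n, ∀ u : List Bool, u.length = n → u ∈ B := by
  let S : ℕ → Set (ℕ → Bool) := fun n => {α | List.ofFn (fun i : Fin n => α i) ∈ B}
  have hopen : ∀ n, IsOpen (S n) := fun n =>
    (isOpen_discrete {f : Fin n → Bool | List.ofFn f ∈ B}).preimage
      (f := fun (α : ℕ → Bool) (i : Fin n) => α i) (by fun_prop)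
  have hmono : Monotone S := by
    refine monotone_nat_of_le_succ fun n α hα => ?_
    change List.ofFn (fun i : Fin (n + 1) => α i) ∈ B
    rw [List.ofFn_succ_last]
    exact hB _ _ hα
  obtain ⟨n, hn⟩ := isCompact_univ.elim_directed_cover S hopen
    (fun α _ => Set.mem_iUnion.2 (hbar α)) hmono.directed_le
  refine ⟨n, fun u hu => ?_⟩
  have h : List.ofFn (fun i : Fin n => u.getD i false) ∈ B :=
    hn (Set.mem_univ fun i => u.getD i false)
  convert h
  subst hu
  simp

/-- Semantic core of the Fourman–Hyland proposition: in any topological model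
the full Fan Theorem holds.  If `b u` is the open truth value of `u ∈ B`,
`b` is monotone under extension, and for every external infinite binary
sequence the truth values of its initial segments cover the space, then the
truth value of "B is uniform" is `⊤`. -/
theorem topological_model_fan_full {X : Type*} [TopologicalSpace X]
    (b : List Bool → TopologicalSpace.Opens X)
    (hmono : ∀ u v : List Bool, b u ≤ b (u ++ v))
    (hbar : ∀ α : ℕ → Bool,
      (⨆ n : ℕ, b (List.ofFn fun i : Fin n => α i)) = ⊤) :
    (⨆ n : ℕ, ⨅ u : {u : List Bool // u.length = n}, b u.1) = ⊤ := by
  rw [eq_top_iff]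
  intro x _
  obtain ⟨n, hn⟩ := exists_uniform_of_bar (B := {u | x ∈ b u}) (fun u v hu => hmono u v hu)
    fun α => TopologicalSpace.Opens.mem_iSup.1 (hbar α ▸ TopologicalSpace.Opens.mem_top x)
  have : Finite {u : List Bool // u.length = n} := List.finite_length_eq Bool n
  refine TopologicalSpace.Opens.mem_iSup.2 ⟨n, ?_⟩
  rw [← SetLike.mem_coe, TopologicalSpace.Opens.coe_iInf]
  exact Set.mem_iInter.2 fun u => hn u.1 u.2
end

section
/- Let H be a complete Heyting algebra (a frame) which is connected, i.e. for all a, b ∈ H, a ⊔ b = ⊤ and a ⊓ b = ⊥ imply a = ⊤ or a = ⊥. Let s : List Bool → ℕ → H be such that every value s u m is complemented in H. Suppose that for every infinite binary sequence α : ℕ → Bool, ⨆_{n ∈ ℕ} ⨅_{m ∈ ℕ} s (α↾n) m ≠ ⊥. Then for every α : ℕ → Bool there exists n ∈ ℕ such that s (α↾n) m = ⊤ for all m ∈ ℕ. (This is the step in the proof that connected Heyting algebras satisfy FAN_Π: the externally defined set B̃ = {u : ∀ m, ⟦(u,m) ∈ S⟧ = ⊤} is itself a bar.) -/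
/-- Step in the proof that connected complete Heyting algebras satisfy
FAN_Π: the externally defined set B̃ = {u : ∀ m, ⟦(u,m) ∈ S⟧ = ⊤} is itself
a bar. -/
theorem connected_frame_pi_bar_external {H : Type*} [Order.Frame H]
    (hconn : ∀ a b : H, a ⊔ b = ⊤ → a ⊓ b = ⊥ → a = ⊤ ∨ a = ⊥)
    (s : List Bool → ℕ → H)
    (hcompl : ∀ (u : List Bool) (m : ℕ), ∃ c : H, s u m ⊔ c = ⊤ ∧ s u m ⊓ c = ⊥)
    (hbar : ∀ α : ℕ → Bool,
      (⨆ n : ℕ, ⨅ m : ℕ, s (List.ofFn fun i : Fin n => α i) m) ≠ ⊥) :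
    ∀ α : ℕ → Bool, ∃ n : ℕ, ∀ m : ℕ,
      s (List.ofFn fun i : Fin n => α i) m = ⊤ := by
  intro α
  by_contra! h
  refine hbar α (iSup_eq_bot.2 fun n => ?_)
  obtain ⟨m, hm⟩ := h n
  obtain ⟨c, hsup, hinf⟩ := hcompl (List.ofFn fun i : Fin n => α i) m
  have hbot := (hconn _ c hsup hinf).resolve_left hm
  exact eq_bot_iff.2 ((iInf_le _ m).trans hbot.le)
end

section
/- Let H be a complete Heyting algebra (a frame) which is connected, i.e. for all a, b ∈ H, a ⊔ b = ⊤ and a ⊓ b = ⊥ imply a = ⊤ or a = ⊥. Let s : List Bool → ℕ → H be such that every value s u m is complemented in H, and suppose that for every infinite binary sequence α : ℕ → Bool, ⨆_{n ∈ ℕ} ⨅_{m ∈ ℕ} s (α↾n) m ≠ ⊥. Then there exists N ∈ ℕ such that for every finite binary sequence u of length N there is some n ≤ N with s (u.take n) m = ⊤ for all m ∈ ℕ. (This is the proposition that any connected Heyting algebra satisfies FAN_Π, the fan theorem for Π⁰₁ bars, in its externalized form: the Π⁰₁ bar presented by s is uniform with a single witness N.) -/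
/-- The fan theorem: a bar in the binary tree is uniform. -/
theorem exists_uniform_bound_of_bar (B : List Bool → Prop)
    (hB : ∀ α : ℕ → Bool, ∃ n : ℕ, B (List.ofFn fun i : Fin n => α i)) :
    ∃ N : ℕ, ∀ u : List Bool, u.length = N → ∃ n ≤ N, B (u.take n) := by
  let U : ℕ → Set (ℕ → Bool) := fun N => {α | ∃ n ≤ N, B (List.ofFn fun i : Fin n => α i)}
  have hopen : ∀ N, IsOpen (U N) := by
    intro N
    have hU : U N = ⋃ n ∈ Set.Iic N,
        (fun (α : ℕ → Bool) (i : Fin n) => α i) ⁻¹' {v | B (List.ofFn v)} := by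
      ext α
      simp [U]
    rw [hU]
    exact isOpen_biUnion fun n _ => (isOpen_discrete _).preimage (by fun_prop)
  have hmono : Monotone U := fun M N hMN α ⟨n, hn, h⟩ => ⟨n, hn.trans hMN, h⟩
  obtain ⟨N, hN⟩ := isCompact_univ.elim_directed_cover U hopen
    (fun α _ => by
      obtain ⟨n, hn⟩ := hB α
      exact Set.mem_iUnion.2 ⟨n, n, le_rfl, hn⟩) hmono.directed_le
  refine ⟨N, fun u hu => ?_⟩
  obtain ⟨n, hn, h⟩ := hN (Set.mem_univ fun i => u.getD i false)
  refine ⟨n, hn, ?_⟩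
  convert h using 1
  refine List.ext_getElem (by simp; omega) fun i hi _ => ?_
  have hiu : i < u.length := by
    rw [List.length_take] at hi
    omega
  simp [hiu]

/-- Connected complete Heyting algebras satisfy FAN_Π (externalized form):
the Π⁰₁ bar presented by `s` is uniform with a single witness `N`. -/
theorem connected_frame_fan_pi {H : Type*} [Order.Frame H]
    (hconn : ∀ a b : H, a ⊔ b = ⊤ → a ⊓ b = ⊥ → a = ⊤ ∨ a = ⊥)
    (s : List Bool → ℕ → H)
    (hcompl : ∀ (u : List Bool) (m : ℕ), ∃ c : H, s u m ⊔ c = ⊤ ∧ s u m ⊓ c = ⊥)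
    (hbar : ∀ α : ℕ → Bool,
      (⨆ n : ℕ, ⨅ m : ℕ, s (List.ofFn fun i : Fin n => α i) m) ≠ ⊥) :
    ∃ N : ℕ, ∀ u : List Bool, u.length = N →
      ∃ n ≤ N, ∀ m : ℕ, s (u.take n) m = ⊤ := by
  refine exists_uniform_bound_of_bar (fun u => ∀ m, s u m = ⊤) fun α => ?_
  by_contra! hα
  refine hbar α (iSup_eq_bot.2 fun n => ?_)
  obtain ⟨m, hm⟩ := hα n
  obtain ⟨c, hc_sup, hc_inf⟩ := hcompl (List.ofFn fun i : Fin n => α i) m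
  exact eq_bot_iff.2 <| (iInf_le _ m).trans ((hconn _ c hc_sup hc_inf).resolve_left hm).le
end
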